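/- Let A ∈ M_{n+1}(ℂ) be symmetric, B ∈ ℂ^{n+1}, C ∈ ℂ, and fix x ∈ ℂ^{n+1}. Then at every z₀ ∈ ℂ for which R_{z₀} := I − z₀A is invertible, the function z ↦ Q_z(x) := xᵀA R_z^{-1} x + 2(R_z^{-1}B)ᵀx + C + z Bᵀ R_z^{-1} B is complex differentiable with derivative ∂_z Q_z(x)|_{z=z₀} = |R_{z₀}^{-1}(Ax + B)|², where |v|² := vᵀv. (Hence, for general quadrics, the equation Q_z(x) = 0 has a multiple root in z exactly at points with isotropic normal, which is the basis of elliptic coordinates.) -/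

import Mathlib

open Matrix

/-- The resolvent-type map `z ↦ (1 - z • a)⁻¹` in a complete normed algebra. -/
theorem hasDerivAt_ringInverse_one_sub_smul {𝕜 R : Type*} [NontriviallyNormedField 𝕜]
    [NormedRing R] [HasSummableGeomSeries R] [NormedAlgebra 𝕜 R] (a : R) {z₀ : 𝕜}
    (h : IsUnit (1 - z₀ • a)) :
    HasDerivAt (fun z : 𝕜 => Ring.inverse (1 - z • a))
      (Ring.inverse (1 - z₀ • a) * a * Ring.inverse (1 - z₀ • a)) z₀ := by
  obtain ⟨u, hu⟩ := h
  have hf : HasDerivAt (fun z : 𝕜 => 1 - z • a) (-a) z₀ := by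
    simpa using ((hasDerivAt_id z₀).smul_const a).const_sub 1
  have hinv : HasFDerivAt Ring.inverse (-ContinuousLinearMap.mulLeftRight 𝕜 R ↑u⁻¹ ↑u⁻¹)
      (1 - z₀ • a) := hu ▸ hasFDerivAt_ringInverse u
  rw [← hu, Ring.inverse_unit]
  simpa [Function.comp_def] using hinv.comp_hasDerivAt z₀ hf

section

attribute [local instance] Matrix.linftyOpNormedRing Matrix.linftyOpNormedAlgebra

theorem Matrix.hasDerivAt_dotProduct_inv_one_sub_smul_mulVec {m : Type*} [Fintype m]
    [DecidableEq m] (A : Matrix m m ℂ) (u v : m → ℂ) {z₀ : ℂ} (h : IsUnit (1 - z₀ • A)) :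
    HasDerivAt (fun z : ℂ => u ⬝ᵥ ((1 - z • A)⁻¹ *ᵥ v))
      (u ⬝ᵥ (((1 - z₀ • A)⁻¹ * A * (1 - z₀ • A)⁻¹) *ᵥ v)) z₀ := by
  let L : Matrix m m ℂ →ₗ[ℂ] ℂ :=
    { toFun := fun M => u ⬝ᵥ (M *ᵥ v)
      map_add' := fun M N => by rw [add_mulVec, dotProduct_add]
      map_smul' := fun c M => by simp [smul_mulVec] }
  have hS := hasDerivAt_ringInverse_one_sub_smul A h
  simp only [← nonsing_inv_eq_ringInverse] at hS
  exact (LinearMap.toContinuousLinearMap L).hasFDerivAt.comp_hasDerivAt z₀ hS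

end

theorem Matrix.IsSymm.mulVec_dotProduct {m R : Type*} [Fintype m] [CommSemiring R]
    {M : Matrix m m R} (hM : M.IsSymm) (u v : m → R) :
    (M *ᵥ u) ⬝ᵥ v = u ⬝ᵥ (M *ᵥ v) := by
  rw [dotProduct_mulVec, ← mulVec_transpose, hM.eq]

/-- The confocal quadratic function `z ↦ Q_z(x)` is complex differentiable where
`R_z = I − zA` is invertible, with derivative the squared (bilinear) norm of the
normal direction `R_z⁻¹(Ax + B)`. -/
theorem confocal_family_deriv {n : ℕ}
    (A : Matrix (Fin (n + 1)) (Fin (n + 1)) ℂ) (B : Fin (n + 1) → ℂ) (C : ℂ)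
    (hA : Aᵀ = A)
    (x : Fin (n + 1) → ℂ) (z₀ : ℂ)
    (hR : IsUnit (1 - z₀ • A)) :
    HasDerivAt
      (fun z : ℂ =>
        x ⬝ᵥ ((A * (1 - z • A)⁻¹) *ᵥ x) + 2 * (((1 - z • A)⁻¹ *ᵥ B) ⬝ᵥ x)
          + C + z * (B ⬝ᵥ ((1 - z • A)⁻¹ *ᵥ B)))
      (((1 - z₀ • A)⁻¹ *ᵥ (A *ᵥ x + B)) ⬝ᵥ ((1 - z₀ • A)⁻¹ *ᵥ (A *ᵥ x + B)))
      z₀ := by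
  have hAs : A.IsSymm := hA
  have hD := fun u v => hasDerivAt_dotProduct_inv_one_sub_smul_mulVec A u v hR
  have hsum := ((((hD (A *ᵥ x) x).add ((hD x B).const_mul 2)).add_const C).add
    ((hasDerivAt_id z₀).mul (hD B B)))
  have hdet := (isUnit_iff_isUnit_det _).1 hR
  have hSs : ((1 - z₀ • A)⁻¹).IsSymm := by
    rw [IsSymm, transpose_nonsing_inv, transpose_sub, transpose_smul, hA, transpose_one]
  have hRS := mul_nonsing_inv _ hdet
  have hSR := nonsing_inv_mul _ hdet
  have hcomm : Commute (1 - z₀ • A)⁻¹ A := by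
    have hRA : (1 - z₀ • A) * A = A * (1 - z₀ • A) := by simp [mul_sub, sub_mul]
    calc (1 - z₀ • A)⁻¹ * A
        = (1 - z₀ • A)⁻¹ * (A * (1 - z₀ • A)) * (1 - z₀ • A)⁻¹ := by
          rw [mul_assoc, mul_assoc A, hRS, mul_one]
      _ = A * (1 - z₀ • A)⁻¹ := by rw [← hRA, ← mul_assoc, hSR, one_mul]
  have hSS : (1 - z₀ • A)⁻¹ * (1 - z₀ • A)⁻¹ =
      (1 - z₀ • A)⁻¹ + z₀ • ((1 - z₀ • A)⁻¹ * A * (1 - z₀ • A)⁻¹) := by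
    calc (1 - z₀ • A)⁻¹ * (1 - z₀ • A)⁻¹
        = (1 - z₀ • A)⁻¹ * ((1 - z₀ • A) + z₀ • A) * (1 - z₀ • A)⁻¹ := by
          rw [sub_add_cancel, mul_one]
      _ = _ := by rw [mul_add, add_mul, hSR, one_mul, mul_smul_comm, smul_mul_assoc]
  refine (hsum.congr_deriv ?_).congr_of_eventuallyEq (.of_forall fun z => ?_)
  · generalize (1 - z₀ • A)⁻¹ = S at *
    have hSAS : S * A * S = S * S * A := by rw [mul_assoc, ← hcomm.eq, mul_assoc]
    have hBB : B ⬝ᵥ ((S * S) *ᵥ B) = B ⬝ᵥ (S *ᵥ B) + z₀ * (B ⬝ᵥ ((S * A * S) *ᵥ B)) := by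
      rw [hSS, add_mulVec, dotProduct_add, smul_mulVec, dotProduct_smul, smul_eq_mul]
    have hxx : (A *ᵥ x) ⬝ᵥ ((S * A * S) *ᵥ x) = (S *ᵥ (A *ᵥ x)) ⬝ᵥ (S *ᵥ (A *ᵥ x)) := by
      rw [hSAS, hSs.mulVec_dotProduct, mulVec_mulVec, mulVec_mulVec]
    have hxB : x ⬝ᵥ ((S * A * S) *ᵥ B) = (S *ᵥ (A *ᵥ x)) ⬝ᵥ (S *ᵥ B) := by
      rw [hcomm.eq, hSs.mulVec_dotProduct, hAs.mulVec_dotProduct, mulVec_mulVec, mulVec_mulVec,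
        mul_assoc]
    have hBS : B ⬝ᵥ ((S * S) *ᵥ B) = (S *ᵥ B) ⬝ᵥ (S *ᵥ B) := by
      rw [hSs.mulVec_dotProduct, mulVec_mulVec]
    rw [mulVec_add, dotProduct_add, add_dotProduct, add_dotProduct, ← hBS, hBB, hxx, hxB,
      dotProduct_comm (S *ᵥ B) (S *ᵥ (A *ᵥ x)), id]
    ring
  · simp only [Pi.add_apply, Pi.mul_apply, id, hAs.mulVec_dotProduct, mulVec_mulVec,
      dotProduct_comm _ x]
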